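/- arXiv:1910.14379 — 5 statements merged into one kernel-verified Lean document; each statement's English description precedes it below -/
import Mathlib

section
/- Let ℓ be a prime, let n ≥ 2, let V be a module over ℤ/ℓⁿℤ and W a module over ℤ/ℓⁿ⁻¹ℤ, and let φ : V → W be an additive map that is semilinear with respect to the natural ring projection π : ℤ/ℓⁿℤ → ℤ/ℓⁿ⁻¹ℤ (i.e. φ(r·v) = π(r)·φ(v) for all r ∈ ℤ/ℓⁿℤ, v ∈ V) and satisfies ℓ·ker(φ) = 0. Then there exists a map P(φ) : Pₙ(V) → Pₙ₋₁(W) between the projectivisations such that for every v ∈ V* the class of φ(v) in Pₙ₋₁(W) equals P(φ) applied to the class of v; i.e. φ descends to the quotients by the respective unit-group scaling actions. -/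
/-- `V* = {v : ℓ^(n-1) • v ≠ 0}`, as a subtype: the elements of a module over
ℤ/ℓⁿℤ not killed by ℓⁿ⁻¹. Its quotient by the scaling action of the unit group
(ℤ/ℓⁿℤ)ˣ is the projectivisation `Pₙ(V)`. -/
def Projectivisation (ℓ n : ℕ) (V : Type*) [AddCommGroup V]
    [Module (ZMod (ℓ ^ n)) V] : Type _ :=
  Quot (fun x y : {v : V // ℓ ^ (n - 1) • v ≠ 0} =>
    ∃ u : (ZMod (ℓ ^ n))ˣ, (u : ZMod (ℓ ^ n)) • (x : V) = (y : V))

theorem pow_nsmul_map_ne_zero {V W : Type*} [AddCommGroup V] [AddCommGroup W] {ℓ n : ℕ}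
    (hn : 2 ≤ n) (φ : V →+ W) (hker : ∀ v : V, φ v = 0 → ℓ • v = 0) {v : V}
    (hv : ℓ ^ (n - 1) • v ≠ 0) : ℓ ^ (n - 1 - 1) • φ v ≠ 0 := by
  intro h
  rw [← map_nsmul] at h
  have h' := hker _ h
  rw [← mul_nsmul', ← pow_succ', Nat.sub_add_cancel (by omega : 1 ≤ n - 1)] at h'
  exact hv h'

/-- Let ℓ be a prime, n ≥ 2, `V` a module over ℤ/ℓⁿℤ and `W` a module
over ℤ/ℓⁿ⁻¹ℤ, and `φ : V → W` an additive map, semilinear with respect to the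
projection `π : ℤ/ℓⁿℤ → ℤ/ℓⁿ⁻¹ℤ`, whose kernel is killed by ℓ.  Then `φ` descends to a
map `P(φ) : Pₙ(V) → Pₙ₋₁(W)` of the projectivisations, sending the class of `v ∈ V*`
to the class of `φ v` (in particular `φ v ∈ W*`). -/
theorem stmt1 (ℓ : ℕ) (hℓ : ℓ.Prime) (n : ℕ) (hn : 2 ≤ n)
    (V W : Type*) [AddCommGroup V] [Module (ZMod (ℓ ^ n)) V]
    [AddCommGroup W] [Module (ZMod (ℓ ^ (n - 1))) W]
    (φ : V →+ W)
    (hsemi : ∀ (r : ZMod (ℓ ^ n)) (v : V),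
      φ (r • v) =
        (ZMod.castHom (pow_dvd_pow ℓ (Nat.sub_le n 1)) (ZMod (ℓ ^ (n - 1))) r) • φ v)
    (hker : ∀ v : V, φ v = 0 → ℓ • v = 0) :
    ∃ P : Projectivisation ℓ n V → Projectivisation ℓ (n - 1) W,
      ∀ (v : V) (hv : ℓ ^ (n - 1) • v ≠ 0),
        ∃ hw : ℓ ^ (n - 1 - 1) • φ v ≠ 0,
          P (Quot.mk _ ⟨v, hv⟩) = Quot.mk _ ⟨φ v, hw⟩ := by
  refine ⟨Quot.map (fun x ↦ ⟨φ x, pow_nsmul_map_ne_zero hn φ hker x.2⟩) ?_,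
    fun v hv ↦ ⟨pow_nsmul_map_ne_zero hn φ hker hv, rfl⟩⟩
  rintro x y ⟨u, hu⟩
  refine ⟨Units.map (ZMod.castHom (pow_dvd_pow ℓ (Nat.sub_le n 1)) (ZMod (ℓ ^ (n - 1)))) u, ?_⟩
  exact (hsemi u x).symm.trans (congrArg φ hu)
end

section
/- Let ℓ be an odd prime and n ≥ 1. The number of orbits of the scaling action of the unit group (ℤ/ℓⁿℤ)ˣ on the set of primitive triples (α,β,γ) ∈ (ℤ/ℓⁿℤ)³ satisfying 2β² = αγ is exactly (ℓ+1)·ℓⁿ⁻¹; equivalently, the number of primitive triples (α,β,γ) ∈ (ℤ/ℓⁿℤ)³ with 2β² = αγ equals (ℓ+1)(ℓ−1)·ℓ^{2n−2}. In particular the cardinality of Dₙ is (ℓ+1)·ℓⁿ⁻¹. -/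
/-- Primitive triples `(α, β, γ)` in (ℤ/ℓⁿℤ)³ (i.e. not killed by ℓⁿ⁻¹, equivalently
not all coordinates divisible by ℓ) satisfying `2β² = αγ`. -/
def DegCone (ℓ n : ℕ) : Type :=
  {v : Fin 3 → ZMod (ℓ ^ n) // ℓ ^ (n - 1) • v ≠ 0 ∧ 2 * v 1 ^ 2 = v 0 * v 2}

/-- `Dₙ`: orbits of the scaling action of (ℤ/ℓⁿℤ)ˣ on the primitive degenerate
triples, i.e. the projectivisation of the cone of degenerate forms in `T/ℓⁿT`. -/
def Dn (ℓ n : ℕ) : Type :=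
  Quot (fun x y : DegCone ℓ n => ∃ u : (ZMod (ℓ ^ n))ˣ, (u : ZMod (ℓ ^ n)) • x.1 = y.1)

theorem ZMod.isUnit_iff_pow_pred_smul_ne_zero {ℓ n : ℕ} (hℓ : ℓ.Prime) (hn : 1 ≤ n)
    (a : ZMod (ℓ ^ n)) : IsUnit a ↔ ℓ ^ (n - 1) • a ≠ 0 := by
  have : NeZero (ℓ ^ n) := ⟨pow_ne_zero _ hℓ.ne_zero⟩
  obtain ⟨k, rfl⟩ : ∃ k : ℕ, (k : ZMod (ℓ ^ n)) = a := ⟨a.val, ZMod.natCast_zmod_val a⟩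
  have hpow : ℓ ^ n = ℓ ^ (n - 1) * ℓ := by rw [← pow_succ, Nat.sub_add_cancel hn]
  rw [ZMod.isUnit_iff_coprime, Nat.coprime_pow_right_iff hn, Nat.coprime_comm,
    hℓ.coprime_iff_not_dvd, nsmul_eq_mul, ← Nat.cast_mul, Ne, ZMod.natCast_eq_zero_iff,
    not_iff_not]
  conv_rhs => rw [hpow]
  exact (Nat.mul_dvd_mul_iff_left (pow_pos hℓ.pos _)).symm

theorem ZMod.isUnit_two_of_odd {m : ℕ} (hm : Odd m) : IsUnit (2 : ZMod m) := by
  have h := (ZMod.isUnit_iff_coprime 2 m).2 (Nat.coprime_two_left.2 hm)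
  exact_mod_cast h

namespace DegCone

variable {ℓ n : ℕ}

theorem primitive_iff (hℓ : ℓ.Prime) (hn : 1 ≤ n) (v : Fin 3 → ZMod (ℓ ^ n)) :
    ℓ ^ (n - 1) • v ≠ 0 ↔ IsUnit (v 0) ∨ IsUnit (v 1) ∨ IsUnit (v 2) := by
  simp only [ZMod.isUnit_iff_pow_pred_smul_ne_zero hℓ hn, Ne, funext_iff, Fin.forall_fin_succ,
    Pi.smul_apply, Pi.zero_apply]
  simp [-nsmul_eq_mul]
  tauto

/-- Representatives of the points of `Dn ℓ n`: the chart `α = 1`, and the points with `γ = 1`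
lying outside that chart. -/
abbrev Chart (ℓ n : ℕ) : Type := ZMod (ℓ ^ n) ⊕ {c : ZMod (ℓ ^ n) // ¬ IsUnit c}

/-- The triple with parameter `s` in its chart. -/
def rep : Chart ℓ n → Fin 3 → ZMod (ℓ ^ n)
  | .inl b => ![1, b, 2 * b ^ 2]
  | .inr c => ![2 * c.1 ^ 2, c.1, 1]

theorem rep_isotropic (s : Chart ℓ n) : 2 * rep s 1 ^ 2 = rep s 0 * rep s 2 := by
  rcases s with b | c <;> simp [rep]

theorem eq_of_smul_rep_eq {u v : (ZMod (ℓ ^ n))ˣ} {s t : Chart ℓ n}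
    (h : (u : ZMod (ℓ ^ n)) • rep s = (v : ZMod (ℓ ^ n)) • rep t) : u = v ∧ s = t := by
  have h0 := congrFun h 0
  have h1 := congrFun h 1
  have h2 := congrFun h 2
  have not_unit (w : (ZMod (ℓ ^ n))ˣ) (c : {c : ZMod (ℓ ^ n) // ¬ IsUnit c}) :
      ¬ IsUnit ((w : ZMod (ℓ ^ n)) * (2 * c.1 ^ 2)) := by
    simp [IsUnit.mul_iff, c.2]
  rcases s with b | c <;> rcases t with b' | c' <;>
    simp only [rep, Pi.smul_apply, smul_eq_mul, Matrix.cons_val, mul_one] at h0 h1 h2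
  · obtain rfl := Units.ext h0
    simpa using h1
  · exact absurd (h0 ▸ u.isUnit) (not_unit v c')
  · exact absurd (h0 ▸ v.isUnit) (not_unit u c)
  · obtain rfl := Units.ext h2
    simpa [Subtype.ext_iff] using h1

theorem exists_smul_rep_eq (hℓ : ℓ.Prime) (hodd : Odd ℓ) (hn : 1 ≤ n) (x : DegCone ℓ n) :
    ∃ (u : (ZMod (ℓ ^ n))ˣ) (s : Chart ℓ n), (u : ZMod (ℓ ^ n)) • rep s = x.1 := by
  obtain ⟨v, hprim, hQ⟩ := x
  rw [primitive_iff hℓ hn] at hprim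
  have h_two : IsUnit (2 : ZMod (ℓ ^ n)) := ZMod.isUnit_two_of_odd hodd.pow
  have hv1 : IsUnit (v 1) → IsUnit (v 0) := fun h =>
    (IsUnit.mul_iff.1 (hQ ▸ h_two.mul (h.pow 2))).1
  by_cases h0 : IsUnit (v 0)
  · obtain ⟨u, hu⟩ := h0
    refine ⟨u, .inl (↑u⁻¹ * v 1), ?_⟩
    have hinv : (u : ZMod (ℓ ^ n)) * ↑u⁻¹ = 1 := u.mul_inv
    rw [← hu] at hQ
    ext i
    fin_cases i
    · simp [rep, hu]
    · simp [rep]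
    · simp [rep]
      linear_combination (↑u⁻¹ : ZMod (ℓ ^ n)) * hQ
        + (2 * v 1 ^ 2 * (↑u⁻¹ : ZMod (ℓ ^ n)) + v 2) * hinv
  · have h1 : ¬ IsUnit (v 1) := mt hv1 h0
    obtain ⟨u, hu⟩ : IsUnit (v 2) := by tauto
    refine ⟨u, .inr ⟨↑u⁻¹ * v 1, by simpa using h1⟩, ?_⟩
    have hinv : (u : ZMod (ℓ ^ n)) * ↑u⁻¹ = 1 := u.mul_inv
    rw [← hu] at hQ
    ext i
    fin_cases i
    · simp [rep]
      linear_combination (↑u⁻¹ : ZMod (ℓ ^ n)) * hQ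
        + (2 * v 1 ^ 2 * (↑u⁻¹ : ZMod (ℓ ^ n)) + v 0) * hinv
    · simp [rep]
    · simp [rep, hu]

/-- The point `u • rep s` of the cone. -/
def ofChart (hℓ : ℓ.Prime) (hn : 1 ≤ n) (p : (ZMod (ℓ ^ n))ˣ × Chart ℓ n) : DegCone ℓ n :=
  ⟨(p.1 : ZMod (ℓ ^ n)) • rep p.2, by
    rw [primitive_iff hℓ hn]
    rcases p with ⟨u, b | c⟩ <;> simp [rep], by
    have h := rep_isotropic p.2
    simp only [Pi.smul_apply, smul_eq_mul]
    linear_combination (p.1 : ZMod (ℓ ^ n)) ^ 2 * h⟩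

theorem ofChart_bijective (hℓ : ℓ.Prime) (hodd : Odd ℓ) (hn : 1 ≤ n) :
    Function.Bijective (ofChart hℓ hn) := by
  refine ⟨fun p q h => Prod.ext_iff.2 (eq_of_smul_rep_eq (congrArg Subtype.val h)), fun x => ?_⟩
  obtain ⟨u, s, h⟩ := exists_smul_rep_eq hℓ hodd hn x
  exact ⟨(u, s), Subtype.ext h⟩

theorem mk_ofChart_one_bijective (hℓ : ℓ.Prime) (hodd : Odd ℓ) (hn : 1 ≤ n) :
    Function.Bijective fun s : Chart ℓ n => (Quot.mk _ (ofChart hℓ hn (1, s)) : Dn ℓ n) := by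
  let e := Equiv.ofBijective _ (ofChart_bijective hℓ hodd hn)
  have h_inv (x y : DegCone ℓ n)
      (h : ∃ u : (ZMod (ℓ ^ n))ˣ, (u : ZMod (ℓ ^ n)) • x.1 = y.1) :
      (e.symm x).2 = (e.symm y).2 := by
    obtain ⟨u, hu⟩ := h
    obtain ⟨p, rfl⟩ := e.surjective x
    obtain ⟨q, rfl⟩ := e.surjective y
    rw [e.symm_apply_apply, e.symm_apply_apply]
    refine (eq_of_smul_rep_eq (u := u * p.1) (v := q.1) ?_).2
    rw [Units.val_mul, mul_smul]
    exact hu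
  constructor
  · intro s t h
    have h' := congrArg (Quot.lift (fun x => (e.symm x).2) h_inv) h
    change (e.symm (e (1, s))).2 = (e.symm (e (1, t))).2 at h'
    simpa using h'
  · rintro ⟨x⟩
    obtain ⟨u, s, h⟩ := exists_smul_rep_eq hℓ hodd hn x
    refine ⟨s, Quot.sound ⟨u, ?_⟩⟩
    simpa [ofChart] using h

theorem card_units (hℓ : ℓ.Prime) (hn : 1 ≤ n) :
    Nat.card (ZMod (ℓ ^ n))ˣ = ℓ ^ (n - 1) * (ℓ - 1) := by
  have : NeZero (ℓ ^ n) := ⟨pow_ne_zero _ hℓ.ne_zero⟩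
  rw [Nat.card_eq_fintype_card, ZMod.card_units_eq_totient, Nat.totient_prime_pow hℓ hn]

theorem card_chart (hℓ : ℓ.Prime) (hn : 1 ≤ n) :
    Nat.card (Chart ℓ n) = (ℓ + 1) * ℓ ^ (n - 1) := by
  classical
  have : NeZero (ℓ ^ n) := ⟨pow_ne_zero _ hℓ.ne_zero⟩
  have h_units : Nat.card {c : ZMod (ℓ ^ n) // IsUnit c} = ℓ ^ (n - 1) * (ℓ - 1) := by
    rw [← card_units hℓ hn]
    exact (Nat.card_eq_of_bijective
      (fun u : (ZMod (ℓ ^ n))ˣ => (⟨u, u.isUnit⟩ : {c : ZMod (ℓ ^ n) // IsUnit c}))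
      ⟨fun _ _ h => Units.ext (congrArg Subtype.val h),
        fun ⟨_, u, hu⟩ => ⟨u, Subtype.ext hu⟩⟩).symm
  have h_sum : Nat.card {c : ZMod (ℓ ^ n) // IsUnit c}
      + Nat.card {c : ZMod (ℓ ^ n) // ¬ IsUnit c} = ℓ ^ n := by
    rw [← Nat.card_sum, Nat.card_congr (Equiv.sumCompl _), Nat.card_zmod]
  rw [Nat.card_sum, Nat.card_zmod]
  have hpow : ℓ ^ n = ℓ ^ (n - 1) * ℓ := by rw [← pow_succ, Nat.sub_add_cancel hn]
  obtain ⟨m, rfl⟩ := Nat.exists_eq_add_of_le' hℓ.one_le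
  rw [h_units, Nat.add_sub_cancel] at h_sum
  nlinarith

end DegCone

/-- For an odd prime ℓ and n ≥ 1, the number of orbits of the scaling
action of (ℤ/ℓⁿℤ)ˣ on primitive triples with `2β² = αγ` is `(ℓ+1)·ℓⁿ⁻¹`, and the
number of primitive degenerate triples is `(ℓ+1)(ℓ−1)·ℓ^(2n−2)`. -/
theorem stmt5 (ℓ : ℕ) (hℓ : ℓ.Prime) (hodd : Odd ℓ) (n : ℕ) (hn : 1 ≤ n) :
    Nat.card (Dn ℓ n) = (ℓ + 1) * ℓ ^ (n - 1) ∧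
      Nat.card (DegCone ℓ n) = (ℓ + 1) * (ℓ - 1) * ℓ ^ (2 * n - 2) := by
  constructor
  · rw [← DegCone.card_chart hℓ hn]
    exact (Nat.card_eq_of_bijective _ (DegCone.mk_ofChart_one_bijective hℓ hodd hn)).symm
  · rw [← Nat.card_eq_of_bijective _ (DegCone.ofChart_bijective hℓ hodd hn),
      Nat.card_prod, DegCone.card_units hℓ hn, DegCone.card_chart hℓ hn,
      show 2 * n - 2 = (n - 1) + (n - 1) by omega, pow_add]
    ring
end

section
/- Let ℓ be an odd prime and n ≥ 2. Under the reduction map (ℤ/ℓⁿℤ)³ → (ℤ/ℓⁿ⁻¹ℤ)³, every primitive triple (α,β,γ) ∈ (ℤ/ℓⁿ⁻¹ℤ)³ with 2β² = αγ has exactly ℓ² preimages that are primitive triples in (ℤ/ℓⁿℤ)³ satisfying 2β² = αγ. Consequently, the induced map of projectivisations πₙ : Dₙ → Dₙ₋₁ is surjective and every fiber has exactly ℓ elements. -/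
/-- Coordinatewise reduction map (ℤ/ℓⁿℤ)³ → (ℤ/ℓⁿ⁻¹ℤ)³. -/
def red (ℓ n : ℕ) (v : Fin 3 → ZMod (ℓ ^ n)) : Fin 3 → ZMod (ℓ ^ (n - 1)) :=
  fun i => ZMod.castHom (pow_dvd_pow ℓ (Nat.sub_le n 1)) (ZMod (ℓ ^ (n - 1))) (v i)

/-- The point with parameter `b` on the conic `2β² = αγ`, normalised so that its `i`-th coordinate
is `1` (for `i ≠ 1`). -/
def conicPoint {R : Type*} [CommRing R] (i : Fin 3) (b : R) : Fin 3 → R :=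
  fun k => if k = 1 then b else if k = i then 1 else 2 * b ^ 2

section Conic

variable {R S : Type*} [CommRing R] [CommRing S] {i : Fin 3}

@[simp]
lemma conicPoint_one (i : Fin 3) (b : R) : conicPoint i b 1 = b := by simp [conicPoint]

lemma conicPoint_self (hi : i ≠ 1) (b : R) : conicPoint i b i = 1 := by simp [conicPoint, hi]

lemma conicPoint_mem (hi : i ≠ 1) (b : R) :
    2 * conicPoint i b 1 ^ 2 = conicPoint i b 0 * conicPoint i b 2 := by
  fin_cases i <;> simp [conicPoint] at hi ⊢

lemma map_conicPoint (f : R →+* S) (b : R) (k : Fin 3) :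
    f (conicPoint i b k) = conicPoint i (f b) k := by
  simp only [conicPoint]
  split_ifs <;> simp [map_ofNat f 2]

lemma smul_mem_conic (u : R) {v : Fin 3 → R} (hv : 2 * v 1 ^ 2 = v 0 * v 2) :
    2 * (u • v) 1 ^ 2 = (u • v) 0 * (u • v) 2 := by
  simp only [Pi.smul_apply, smul_eq_mul]
  linear_combination u ^ 2 * hv

lemma eq_smul_conicPoint (hi : i ≠ 1) {v : Fin 3 → R} (hv : 2 * v 1 ^ 2 = v 0 * v 2) {u : Rˣ}
    (hu : (u : R) = v i) : v = (u : R) • conicPoint i (↑u⁻¹ * v 1) := by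
  have h1 : (u : R) * ↑u⁻¹ = 1 := u.mul_inv
  funext k
  fin_cases i
  · fin_cases k <;> simp [conicPoint] at hu ⊢
    · exact hu.symm
    · linear_combination (-(↑u⁻¹ : R)) * hv + ↑u⁻¹ * v 2 * hu - v 2 * h1
        - 2 * v 1 ^ 2 * ↑u⁻¹ * h1
  · simp at hi
  · fin_cases k <;> simp [conicPoint] at hu ⊢
    · linear_combination (-(↑u⁻¹ : R)) * hv + ↑u⁻¹ * v 0 * hu - v 0 * h1
        - 2 * v 1 ^ 2 * ↑u⁻¹ * h1
    · exact hu.symm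

lemma exists_isUnit_of_mem_conic (h2 : IsUnit (2 : R)) {v : Fin 3 → R}
    (hv : 2 * v 1 ^ 2 = v 0 * v 2) (h : ∃ k, IsUnit (v k)) : ∃ i, i ≠ 1 ∧ IsUnit (v i) := by
  obtain ⟨k, hk⟩ := h
  by_cases hk1 : k = 1
  · subst hk1
    exact ⟨0, by decide, isUnit_of_mul_isUnit_left (hv ▸ h2.mul (hk.pow 2))⟩
  · exact ⟨k, hk1, hk⟩

/-- Over a point of the conic with invertible `i`-th coordinate, the points of the conic reducing
to it are parametrised by the lifts of its `i`-th and middle coordinates. -/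
lemma card_conic_lifts (f : R →+* S) [IsLocalHom f] (hi : i ≠ 1) {w : Fin 3 → S}
    (hw : 2 * w 1 ^ 2 = w 0 * w 2) (hwi : IsUnit (w i)) :
    Nat.card {v : Fin 3 → R //
      ((∃ k, IsUnit (v k)) ∧ 2 * v 1 ^ 2 = v 0 * v 2) ∧ (fun k => f (v k)) = w} =
      Nat.card {a : R // f a = w i} * Nat.card {b : R // f b = w 1} := by
  have hunit {a : R} (ha : f a = w i) : IsUnit a := isUnit_of_map_unit f a (ha ▸ hwi)
  rw [← Nat.card_prod]
  refine Nat.card_congr (Equiv.ofBijective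
    (fun v => (⟨v.1 i, congrFun v.2.2 i⟩, ⟨v.1 1, congrFun v.2.2 1⟩)) ⟨?_, ?_⟩)
  · rintro ⟨v, hv, hvw⟩ ⟨v', hv', hvw'⟩ h
    simp only [Prod.mk.injEq, Subtype.mk.injEq] at h ⊢
    obtain ⟨u, hu⟩ := hunit (congrFun hvw i)
    rw [eq_smul_conicPoint hi hv.2 hu, eq_smul_conicPoint hi hv'.2 (hu.trans h.1), h.2]
  · rintro ⟨⟨a, ha⟩, ⟨b, hb⟩⟩
    obtain ⟨u, rfl⟩ := hunit ha
    refine ⟨⟨(u : R) • conicPoint i (↑u⁻¹ * b),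
      ⟨⟨i, by simp [conicPoint_self hi]⟩, smul_mem_conic _ (conicPoint_mem hi _)⟩, ?_⟩, ?_⟩
    · rw [eq_smul_conicPoint hi hw (u := Units.map (f : R →* S) u) (by simpa using ha)]
      funext k
      simp [map_conicPoint, ← hb, ← map_inv]
    · simp [conicPoint_self hi]

end Conic

lemma RingHom.card_fiber_mul_card {R S : Type*} [Ring R] [Ring S] {f : R →+* S}
    (hf : Function.Surjective f) (s : S) :
    Nat.card {a : R // f a = s} * Nat.card S = Nat.card R := by
  obtain ⟨r, rfl⟩ := hf s
  have hker : Nat.card {a : R // f a = f r} = Nat.card f.toAddMonoidHom.ker :=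
    Nat.card_congr ((Equiv.subRight r).subtypeEquiv fun a => by
      simp [AddMonoidHom.mem_ker, sub_eq_zero])
  rw [hker, ← AddSubgroup.card_mul_index f.toAddMonoidHom.ker, AddSubgroup.index_ker,
    AddMonoidHom.range_eq_top.2 hf, Nat.card_congr AddSubgroup.topEquiv.toEquiv]

section PrimePower

variable {ℓ n : ℕ}

lemma isUnit_natCast_zmod_pow (hℓ : ℓ.Prime) (hn : n ≠ 0) (k : ℕ) :
    IsUnit (k : ZMod (ℓ ^ n)) ↔ ¬ ℓ ∣ k := by
  rw [ZMod.isUnit_iff_coprime, Nat.coprime_pow_right_iff (Nat.pos_of_ne_zero hn),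
    Nat.coprime_comm, hℓ.coprime_iff_not_dvd]

lemma primitive_iff_exists_isUnit (hℓ : ℓ.Prime) (hn : n ≠ 0) (v : Fin 3 → ZMod (ℓ ^ n)) :
    ℓ ^ (n - 1) • v ≠ 0 ↔ ∃ k, IsUnit (v k) := by
  have : NeZero (ℓ ^ n) := ⟨pow_ne_zero _ hℓ.ne_zero⟩
  rw [Function.ne_iff]
  refine exists_congr fun k => ?_
  obtain ⟨a, ha⟩ := ZMod.natCast_zmod_surjective (v k)
  obtain ⟨m, rfl⟩ := Nat.exists_eq_succ_of_ne_zero hn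
  rw [← ha, isUnit_natCast_zmod_pow hℓ hn, Pi.smul_apply, ← ha, nsmul_eq_mul, ← Nat.cast_mul,
    Pi.zero_apply, ne_eq, ZMod.natCast_eq_zero_iff, Nat.succ_eq_add_one, Nat.add_sub_cancel,
    pow_succ, Nat.mul_dvd_mul_iff_left (pow_pos hℓ.pos m)]

/-- Reduction of a single coordinate. -/
abbrev redHom (ℓ n : ℕ) : ZMod (ℓ ^ n) →+* ZMod (ℓ ^ (n - 1)) :=
  ZMod.castHom (pow_dvd_pow ℓ (Nat.sub_le n 1)) (ZMod (ℓ ^ (n - 1)))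

lemma isLocalHom_redHom (hℓ : ℓ.Prime) (hn : 2 ≤ n) : IsLocalHom (redHom ℓ n) where
  map_nonunit x hx := by
    have : NeZero (ℓ ^ n) := ⟨pow_ne_zero _ hℓ.ne_zero⟩
    obtain ⟨a, rfl⟩ := ZMod.natCast_zmod_surjective x
    rw [map_natCast, isUnit_natCast_zmod_pow hℓ (by omega)] at hx
    rwa [isUnit_natCast_zmod_pow hℓ (by omega)]

lemma card_redHom_fiber (hℓ : ℓ.Prime) (hn : n ≠ 0) (s : ZMod (ℓ ^ (n - 1))) :
    Nat.card {a : ZMod (ℓ ^ n) // redHom ℓ n a = s} = ℓ := by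
  have h := RingHom.card_fiber_mul_card (ZMod.castHom_surjective
    (pow_dvd_pow ℓ (Nat.sub_le n 1))) s
  rw [Nat.card_zmod, Nat.card_zmod] at h
  exact Nat.eq_of_mul_eq_mul_right (pow_pos hℓ.pos _) (h.trans (mul_pow_sub_one hn ℓ).symm)

lemma isUnit_two_zmod_pow (hℓ : ℓ.Prime) (hodd : Odd ℓ) (hn : n ≠ 0) :
    IsUnit (2 : ZMod (ℓ ^ n)) := by
  have h := (isUnit_natCast_zmod_pow hℓ hn 2).2 fun h => by
    rw [(Nat.prime_dvd_prime_iff_eq hℓ Nat.prime_two).1 h] at hodd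
    exact absurd hodd (by decide)
  exact_mod_cast h

lemma exists_isUnit_of_degenerate (hℓ : ℓ.Prime) (hodd : Odd ℓ) (hn : n ≠ 0)
    {v : Fin 3 → ZMod (ℓ ^ n)} (hv : ℓ ^ (n - 1) • v ≠ 0 ∧ 2 * v 1 ^ 2 = v 0 * v 2) :
    ∃ i, i ≠ 1 ∧ IsUnit (v i) :=
  exists_isUnit_of_mem_conic (isUnit_two_zmod_pow hℓ hodd hn) hv.2
    ((primitive_iff_exists_isUnit hℓ hn v).1 hv.1)

lemma conicPoint_degenerate (hℓ : ℓ.Prime) (hn : n ≠ 0) {i : Fin 3} (hi : i ≠ 1)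
    (b : ZMod (ℓ ^ n)) :
    ℓ ^ (n - 1) • conicPoint i b ≠ 0 ∧
      2 * conicPoint i b 1 ^ 2 = conicPoint i b 0 * conicPoint i b 2 :=
  ⟨(primitive_iff_exists_isUnit hℓ hn _).2 ⟨i, by simp [conicPoint_self hi]⟩,
    conicPoint_mem hi b⟩

lemma red_conicPoint (i : Fin 3) (b : ZMod (ℓ ^ n)) :
    red ℓ n (conicPoint i b) = conicPoint i (redHom ℓ n b) :=
  funext fun k => map_conicPoint (redHom ℓ n) b k

lemma red_degenerate (hℓ : ℓ.Prime) (hn : 2 ≤ n) {v : Fin 3 → ZMod (ℓ ^ n)}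
    (hv : ℓ ^ (n - 1) • v ≠ 0 ∧ 2 * v 1 ^ 2 = v 0 * v 2) :
    ℓ ^ (n - 1 - 1) • red ℓ n v ≠ 0 ∧ 2 * red ℓ n v 1 ^ 2 = red ℓ n v 0 * red ℓ n v 2 := by
  have h := congrArg (redHom ℓ n) hv.2
  simp only [map_mul, map_pow, map_ofNat] at h
  refine ⟨?_, h⟩
  rw [primitive_iff_exists_isUnit hℓ (by omega)] at hv ⊢
  exact hv.1.imp fun k hk => hk.map (redHom ℓ n)

lemma Dn.mk_eq_mk_iff {x y : DegCone ℓ n} :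
    (Quot.mk _ x : Dn ℓ n) = Quot.mk _ y ↔
      ∃ u : (ZMod (ℓ ^ n))ˣ, (u : ZMod (ℓ ^ n)) • x.1 = y.1 := by
  refine Quot.eq.trans (Equivalence.eqvGen_iff ⟨fun x => ⟨1, by simp⟩, ?_, ?_⟩)
  · rintro x y ⟨u, hu⟩
    exact ⟨u⁻¹, by rw [← hu, smul_smul, Units.inv_mul, one_smul]⟩
  · rintro x y z ⟨u, hu⟩ ⟨u', hu'⟩
    exact ⟨u' * u, by rw [← hu', ← hu, smul_smul, Units.val_mul]⟩

/-- The map `Dₙ → Dₙ₋₁` induced by coordinatewise reduction. -/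
def Dn.reduction (hℓ : ℓ.Prime) (hn : 2 ≤ n) : Dn ℓ n → Dn ℓ (n - 1) :=
  Quot.map (fun v => ⟨red ℓ n v.1, red_degenerate hℓ hn v.2⟩) fun _ _ ⟨u, hu⟩ =>
    ⟨Units.map (redHom ℓ n : ZMod (ℓ ^ n) →* ZMod (ℓ ^ (n - 1))) u,
      funext fun k =>
        (map_mul (redHom ℓ n) _ _).symm.trans (congrArg (redHom ℓ n) (congrFun hu k))⟩

lemma Dn.card_reduction_fiber (hℓ : ℓ.Prime) (hodd : Odd ℓ) (hn : 2 ≤ n) (y : Dn ℓ (n - 1)) :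
    Nat.card {x : Dn ℓ n // Dn.reduction hℓ hn x = y} = ℓ := by
  have hn0 : n ≠ 0 := by omega
  have := isLocalHom_redHom hℓ hn
  induction y using Quot.ind with | mk w =>
  obtain ⟨w, hw⟩ := w
  obtain ⟨i, hi, u, hu⟩ := exists_isUnit_of_degenerate hℓ hodd (by omega) hw
  have hwu := eq_smul_conicPoint hi hw.2 hu
  have hlift (b : {b // redHom ℓ n b = ↑u⁻¹ * w 1}) : Dn.reduction hℓ hn
      (Quot.mk _ ⟨conicPoint i b.1, conicPoint_degenerate hℓ hn0 hi b.1⟩) = Quot.mk _ ⟨w, hw⟩ := by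
    refine Dn.mk_eq_mk_iff.2 ⟨u, ?_⟩
    simp only [red_conicPoint, b.2]
    exact hwu.symm
  refine Eq.trans (Nat.card_congr (Equiv.ofBijective (fun b => ⟨_, hlift b⟩) ⟨?_, ?_⟩).symm)
    (card_redHom_fiber hℓ hn0 (↑u⁻¹ * w 1))
  · rintro ⟨b, hb⟩ ⟨b', hb'⟩ h
    obtain ⟨t, ht⟩ := Dn.mk_eq_mk_iff.1 (Subtype.mk.inj h)
    have hti := congrFun ht i
    have ht1 := congrFun ht 1
    simp only [Pi.smul_apply, smul_eq_mul, conicPoint_self hi, conicPoint_one, mul_one] at hti ht1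
    exact Subtype.ext (by simpa [hti] using ht1)
  · rintro ⟨x, hx⟩
    induction x using Quot.ind with | mk v =>
    obtain ⟨v, hv⟩ := v
    obtain ⟨t, ht⟩ := Dn.mk_eq_mk_iff.1 hx
    have hti : (t : ZMod (ℓ ^ (n - 1))) * redHom ℓ n (v i) = w i := congrFun ht i
    have ht1 : (t : ZMod (ℓ ^ (n - 1))) * redHom ℓ n (v 1) = w 1 := congrFun ht 1
    obtain ⟨s, hs⟩ : IsUnit (v i) := isUnit_of_map_unit (redHom ℓ n) _
      (isUnit_of_mul_isUnit_right (hti ▸ hu ▸ u.isUnit))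
    refine ⟨⟨↑s⁻¹ * v 1, ?_⟩, Subtype.ext (Dn.mk_eq_mk_iff.2
      ⟨s, (eq_smul_conicPoint hi hv.2 hs).symm⟩)⟩
    have hs1 : redHom ℓ n s * redHom ℓ n ↑s⁻¹ = 1 := by rw [← map_mul, s.mul_inv, map_one]
    rw [← hu, ← hs] at hti
    rw [Units.eq_inv_mul_iff_mul_eq, map_mul, ← ht1, ← hti]
    linear_combination (t : ZMod (ℓ ^ (n - 1))) * redHom ℓ n (v 1) * hs1

end PrimePower

/-- For an odd prime ℓ and n ≥ 2: every primitive triple over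
ℤ/ℓⁿ⁻¹ℤ with `2β² = αγ` has exactly `ℓ²` preimages under the reduction map that are
primitive triples over ℤ/ℓⁿℤ with `2β² = αγ`; consequently the induced map
`πₙ : Dₙ → Dₙ₋₁` of projectivisations is surjective and all its fibers have exactly
`ℓ` elements. -/
theorem stmt6 (ℓ : ℕ) (hℓ : ℓ.Prime) (hodd : Odd ℓ) (n : ℕ) (hn : 2 ≤ n) :
    (∀ w : Fin 3 → ZMod (ℓ ^ (n - 1)),
      ℓ ^ (n - 1 - 1) • w ≠ 0 → 2 * w 1 ^ 2 = w 0 * w 2 →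
        Nat.card {v : Fin 3 → ZMod (ℓ ^ n) //
          (ℓ ^ (n - 1) • v ≠ 0 ∧ 2 * v 1 ^ 2 = v 0 * v 2) ∧ red ℓ n v = w} = ℓ ^ 2) ∧
    ∃ π : Dn ℓ n → Dn ℓ (n - 1),
      (∀ (v : Fin 3 → ZMod (ℓ ^ n))
          (hv : ℓ ^ (n - 1) • v ≠ 0 ∧ 2 * v 1 ^ 2 = v 0 * v 2),
        ∃ hw : ℓ ^ (n - 1 - 1) • red ℓ n v ≠ 0 ∧
            2 * red ℓ n v 1 ^ 2 = red ℓ n v 0 * red ℓ n v 2,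
          π (Quot.mk _ ⟨v, hv⟩) = Quot.mk _ ⟨red ℓ n v, hw⟩) ∧
      Function.Surjective π ∧
      ∀ y : Dn ℓ (n - 1), Nat.card {x : Dn ℓ n // π x = y} = ℓ := by
  have := isLocalHom_redHom hℓ hn
  refine ⟨fun w hw hw' => ?_, Dn.reduction hℓ hn,
    fun v hv => ⟨red_degenerate hℓ hn hv, rfl⟩, fun y => ?_, Dn.card_reduction_fiber hℓ hodd hn⟩
  · obtain ⟨i, hi, hwi⟩ := exists_isUnit_of_degenerate hℓ hodd (by omega) ⟨hw, hw'⟩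
    have h := card_conic_lifts (redHom ℓ n) hi hw' hwi
    rw [card_redHom_fiber hℓ (by omega), card_redHom_fiber hℓ (by omega), ← sq] at h
    simp only [primitive_iff_exists_isUnit hℓ (show n ≠ 0 by omega)]
    exact h
  · have h : Nat.card {x : Dn ℓ n // Dn.reduction hℓ hn x = y} ≠ 0 := by
      rw [Dn.card_reduction_fiber hℓ hodd hn y]
      exact hℓ.ne_zero
    obtain ⟨⟨x, hx⟩⟩ := (Nat.card_ne_zero.1 h).1
    exact ⟨x, hx⟩
end

section
/- Let ℓ be an odd prime and n ≥ 1. The group of transformations of (ℤ/ℓⁿℤ)³ generated by the maps A(a,b,c,d) : (α,β,γ) ↦ (a²α + 4acβ + 2c²γ, abα + (ad + 2bc)β + cdγ, 2b²α + 4bdβ + d²γ), where a, b, c, d range over all elements of ℤ/ℓⁿℤ with ad − 2bc = 1, acts transitively on Dₙ: for any two primitive triples v, w ∈ (ℤ/ℓⁿℤ)³ with 2β² = αγ, there exist such a transformation A and a unit u ∈ (ℤ/ℓⁿℤ)ˣ with A(v) = u·w. -/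
/-- The transformation `A(a,b,c,d)` of `R³`:
`(α,β,γ) ↦ (a²α + 4acβ + 2c²γ, abα + (ad + 2bc)β + cdγ, 2b²α + 4bdβ + d²γ)`. -/
def Amap {R : Type*} [CommRing R] (a b c d : R) : (Fin 3 → R) → (Fin 3 → R) :=
  fun v =>
    ![a ^ 2 * v 0 + 4 * a * c * v 1 + 2 * c ^ 2 * v 2,
      a * b * v 0 + (a * d + 2 * b * c) * v 1 + c * d * v 2,
      2 * b ^ 2 * v 0 + 4 * b * d * v 1 + d ^ 2 * v 2]

/-- A non-unit of `ZMod (ℓ ^ n)` is killed by `ℓ ^ (n - 1)`. -/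
theorem ZMod.isUnit_of_prime_pow_smul_ne_zero {ℓ n : ℕ} (hℓ : ℓ.Prime) (hn : 1 ≤ n)
    {x : ZMod (ℓ ^ n)} (hx : ℓ ^ (n - 1) • x ≠ 0) : IsUnit x := by
  have : NeZero (ℓ ^ n) := ⟨pow_ne_zero _ hℓ.ne_zero⟩
  by_contra hu
  refine hx ?_
  rw [← ZMod.natCast_zmod_val x, ZMod.isUnit_iff_coprime, Nat.coprime_pow_right_iff hn,
    Nat.coprime_comm, hℓ.coprime_iff_not_dvd, not_not] at hu
  obtain ⟨k, hk⟩ := hu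
  rw [← ZMod.natCast_zmod_val x, hk, nsmul_eq_mul, ← Nat.cast_mul, ← mul_assoc, ← pow_succ,
    Nat.sub_add_cancel hn, Nat.cast_mul, ZMod.natCast_self, zero_mul]

/-- A solution of `2β² = αγ` with a unit coordinate is a unit multiple of the first column
`(a², ab, 2b²)` of some `A(a,b,c,d)` with `ad − 2bc = 1`. -/
theorem exists_eq_smul_of_isUnit_coord {R : Type*} [CommRing R] (h2 : IsUnit (2 : R))
    {v : Fin 3 → R} (hv : 2 * v 1 ^ 2 = v 0 * v 2) {i : Fin 3} (hi : IsUnit (v i)) :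
    ∃ (a b c d : R) (r : Rˣ), a * d - 2 * b * c = 1 ∧
      v = (r : R) • ![a ^ 2, a * b, 2 * b ^ 2] := by
  have hor : IsUnit (v 0) ∨ IsUnit (v 2) := by
    fin_cases i
    · exact Or.inl hi
    · exact Or.inl (isUnit_of_mul_isUnit_left (hv ▸ h2.mul (hi.pow 2)))
    · exact Or.inr hi
  rcases hor with h | h
  · obtain ⟨r, hr⟩ := h
    have hrr : (r : R) * ↑r⁻¹ = 1 := r.mul_inv
    refine ⟨1, ↑r⁻¹ * v 1, 0, 1, r, by ring, ?_⟩
    rw [← hr] at hv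
    ext j
    fin_cases j <;> simp
    · exact hr.symm
    · linear_combination (-2 * ↑r⁻¹ * v 1 ^ 2) * hrr - ↑r⁻¹ * hv - v 2 * hrr
  · obtain ⟨r, hr⟩ := h
    obtain ⟨t, ht⟩ := h2
    have hrr : (r : R) * ↑r⁻¹ = 1 := r.mul_inv
    have htt : (2 : R) * ↑t⁻¹ = 1 := by rw [← ht]; exact t.mul_inv
    refine ⟨2 * (↑r⁻¹ * v 1), 1, -↑t⁻¹, 0, r * t⁻¹, by linear_combination htt, ?_⟩
    rw [← hr] at hv
    ext j
    fin_cases j <;> simp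
    · linear_combination (-2 * ↑r⁻¹ * v 1 ^ 2) * hrr - ↑r⁻¹ * hv - v 0 * hrr -
        2 * ↑r * ↑r⁻¹ ^ 2 * v 1 ^ 2 * htt
    · linear_combination -v 1 * hrr - ↑r * ↑r⁻¹ * v 1 * htt
    · linear_combination -hr - ↑r * htt

theorem Amap_smul_single {R : Type*} [CommRing R] (a b c d r : R) :
    Amap a b c d (r • ![1, 0, 0]) = r • ![a ^ 2, a * b, 2 * b ^ 2] := by
  ext j
  fin_cases j <;> simp [Amap] <;> ring

/-- `A(d,−b,−c,a)` inverts `A(a,b,c,d)` on the first column. -/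
theorem Amap_smul_column {R : Type*} [CommRing R] {a b c d : R} (h : a * d - 2 * b * c = 1)
    (r : R) :
    Amap d (-b) (-c) a (r • ![a ^ 2, a * b, 2 * b ^ 2]) = r • ![1, 0, 0] := by
  ext j
  fin_cases j <;> simp [Amap]
  · linear_combination r * (a * d - 2 * b * c + 1) * h
  · ring
  · ring

/-- For an odd prime ℓ and n ≥ 1, the group of transformations of
(ℤ/ℓⁿℤ)³ generated by the maps `A(a,b,c,d)` with `ad − 2bc = 1` acts transitively on
`Dₙ`: for any two primitive triples `v, w` with `2β² = αγ` there are a transformation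
`A` in the generated group and a unit `u` with `A v = u • w`. -/
theorem stmt9 (ℓ : ℕ) (hℓ : ℓ.Prime) (hodd : Odd ℓ) (n : ℕ) (hn : 1 ≤ n)
    (v w : Fin 3 → ZMod (ℓ ^ n))
    (hv1 : ℓ ^ (n - 1) • v ≠ 0) (hv2 : 2 * v 1 ^ 2 = v 0 * v 2)
    (hw1 : ℓ ^ (n - 1) • w ≠ 0) (hw2 : 2 * w 1 ^ 2 = w 0 * w 2) :
    ∃ A ∈ Submonoid.closure {f : Function.End (Fin 3 → ZMod (ℓ ^ n)) |
        ∃ a b c d : ZMod (ℓ ^ n), a * d - 2 * b * c = 1 ∧ f = Amap a b c d},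
      ∃ u : (ZMod (ℓ ^ n))ˣ, A v = (u : ZMod (ℓ ^ n)) • w := by
  have h2 : IsUnit (2 : ZMod (ℓ ^ n)) := by
    have := (ZMod.isUnit_iff_coprime 2 (ℓ ^ n)).2
      ((Nat.coprime_two_left.2 hodd).pow_right n)
    exact_mod_cast this
  have key : ∀ v : Fin 3 → ZMod (ℓ ^ n), ℓ ^ (n - 1) • v ≠ 0 → ∃ i, IsUnit (v i) := by
    intro v hv
    obtain ⟨i, hi⟩ := Function.ne_iff.1 hv
    exact ⟨i, ZMod.isUnit_of_prime_pow_smul_ne_zero hℓ hn hi⟩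
  obtain ⟨i, hi⟩ := key v hv1
  obtain ⟨j, hj⟩ := key w hw1
  obtain ⟨a, b, c, d, r, h, hv⟩ := exists_eq_smul_of_isUnit_coord h2 hv2 hi
  obtain ⟨a', b', c', d', r', h', hw⟩ := exists_eq_smul_of_isUnit_coord h2 hw2 hj
  refine ⟨_, mul_mem (Submonoid.subset_closure ⟨a', b', c', d', h', rfl⟩)
    (Submonoid.subset_closure ⟨d, -b, -c, a, by linear_combination h, rfl⟩), r * r'⁻¹, ?_⟩
  change Amap a' b' c' d' (Amap d (-b) (-c) a v) = _
  rw [hv, hw, Amap_smul_column h, Amap_smul_single, smul_smul, ← Units.val_mul,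
    inv_mul_cancel_right]
end

section
/- Let p be a prime with p ≡ 3 (mod 4), let q = p², and let X ⊂ ℙ³ be the Fermat quartic surface defined by x₀⁴ + x₁⁴ + x₂⁴ + x₃⁴ = 0 over 𝔽_q. Then for every integer m ≥ 1, the number of points of X over 𝔽_{q^m} equals q^{2m} + 22·q^m + 1; that is, #{[x₀:x₁:x₂:x₃] ∈ ℙ³(𝔽_{p^{2m}}) : x₀⁴ + x₁⁴ + x₂⁴ + x₃⁴ = 0} = p^{4m} + 22·p^{2m} + 1. In particular X is strongly supersingular in degree 2 over 𝔽_{p²}: the Frobenius of 𝔽_q acts on the 22-dimensional second étale cohomology of X as multiplication by q. -/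
open Finset in
/-- On a finite cyclic group, a function invariant under the fourth power of a generator is
averaged by its values at the first four powers of that generator. -/
lemma four_mul_sum_of_invariant {G : Type*} [CommGroup G] [Fintype G] {g : G}
    (hg : ∀ t, t ∈ Subgroup.zpowers g) (F : G → ℂ) (hF : ∀ t, F (g ^ 4 * t) = F t) :
    4 * ∑ t, F t = Fintype.card G * (F 1 + F g + F (g ^ 2) + F (g ^ 3)) := by
  have shift (k : ℕ) : ∑ t, F (g ^ k * t) = ∑ t, F t :=
    Equiv.sum_comp (Equiv.mulLeft (g ^ k)) F
  have hconst (t : G) : F t + F (g * t) + F (g ^ 2 * t) + F (g ^ 3 * t) =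
      F 1 + F g + F (g ^ 2) + F (g ^ 3) := by
    obtain ⟨k, rfl⟩ := mem_powers_iff_mem_zpowers.mpr (hg t)
    simp only
    induction k with
    | zero => simp
    | succ k ih =>
      rw [← ih, show g ^ 3 * g ^ (k + 1) = g ^ 4 * g ^ k by group, hF,
        show g ^ 2 * g ^ (k + 1) = g ^ 3 * g ^ k by group,
        show g * g ^ (k + 1) = g ^ 2 * g ^ k by group, pow_succ' g k]
      ring
  have h := Finset.sum_congr (rfl : (univ : Finset G) = univ) fun t _ => hconst t
  simp only [sum_add_distrib, sum_const, card_univ, nsmul_eq_mul] at h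
  have h1 := shift 1
  rw [pow_one] at h1
  rw [h1, shift, shift] at h
  linear_combination h

section CharacterSums

variable {K : Type*} [Field K] [Fintype K]

lemma sum_sum_addChar_mul {ψ : AddChar K ℂ} (hψ : ψ.IsPrimitive) {α : Type*} [Fintype α]
    (f : α → K) :
    ∑ t, ∑ a, ψ (t * f a) = Fintype.card K * (Nat.card {a // f a = 0} : ℂ) := by
  classical
  rw [Finset.sum_comm]
  simp_rw [AddChar.sum_mulShift _ hψ]
  rw [Nat.card_eq_fintype_card, Fintype.card_subtype]
  push_cast
  rw [Finset.sum_ite]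
  simp [mul_comm]

/-- The exponential sum `∑ x, ψ (t * x ^ 4)`. -/
noncomputable def quarticSum (ψ : AddChar K ℂ) (t : K) : ℂ := ∑ x, ψ (t * x ^ 4)

lemma quarticSum_zero (ψ : AddChar K ℂ) : quarticSum ψ 0 = Fintype.card K := by
  simp [quarticSum]

lemma quarticSum_pow_four_mul (ψ : AddChar K ℂ) (u : Kˣ) (t : K) :
    quarticSum ψ ((u : K) ^ 4 * t) = quarticSum ψ t := by
  rw [quarticSum, quarticSum, ← Equiv.sum_comp (Units.mulLeft u) fun x => ψ (t * x ^ 4)]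
  refine Finset.sum_congr rfl fun x _ => ?_
  congr 1
  simp only [Units.mulLeft_apply]
  ring

lemma quarticSum_pow_char (p : ℕ) [Fact p.Prime] [CharP K p] {ψ : AddChar K ℂ}
    (hfrob : ∀ x, ψ (x ^ p) = ψ x) (t : K) : quarticSum ψ (t ^ p) = quarticSum ψ t := by
  rw [quarticSum, quarticSum,
    ← Equiv.sum_comp (frobeniusEquiv K p).toEquiv fun x => ψ (t ^ p * x ^ 4)]
  refine Finset.sum_congr rfl fun x _ => ?_
  rw [← hfrob (t * x ^ 4)]
  congr 1
  simp [frobenius_def]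
  ring

lemma sum_univ_eq_zero_add_units [DecidableEq K] {M : Type*} [AddCommMonoid M] (F : K → M) :
    ∑ t, F t = F 0 + ∑ u : Kˣ, F u := by
  rw [Fintype.sum_eq_add_sum_compl 0]
  congr 1
  refine (Finset.sum_bij (fun (u : Kˣ) _ => (u : K)) (by simp) (fun _ _ _ _ h => Units.ext h)
    (fun t ht => ⟨Units.mk0 t (by simpa using ht), by simp⟩) fun _ _ => rfl).symm

/-- The trace form gives a primitive additive character that is invariant under Frobenius. -/
lemma exists_isPrimitive_frobenius_invariant (p : ℕ) [Fact p.Prime] [CharP K p] :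
    ∃ ψ : AddChar K ℂ, ψ.IsPrimitive ∧ ∀ x, ψ (x ^ p) = ψ x := by
  let _ : Algebra (ZMod p) K := ZMod.algebra K p
  let ψ : AddChar K ℂ :=
    (ZMod.stdAddChar (N := p)).compAddMonoidHom (Algebra.trace (ZMod p) K).toAddMonoidHom
  refine ⟨ψ, AddChar.IsPrimitive.of_ne_one ?_, fun x => ?_⟩
  · obtain ⟨a, ha⟩ := Algebra.trace_surjective (ZMod p) K 1
    refine AddChar.ne_one_iff.mpr ⟨a, fun h => one_ne_zero (α := ZMod p) ?_⟩
    rw [← ha]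
    refine ZMod.injective_stdAddChar ?_
    rw [AddChar.map_zero_eq_one]
    exact h
  · have h := Algebra.trace_eq_of_algEquiv (FiniteField.frobeniusAlgEquiv (ZMod p) K p) x
    rw [FiniteField.frobeniusAlgEquiv_apply, ZMod.card] at h
    exact congrArg (ZMod.stdAddChar (N := p)) h

lemma sum_quarticSum_mul_quarticSum {ψ : AddChar K ℂ} (hψ : ψ.IsPrimitive) {c : K}
    (hc : ∀ x y : K, x ^ 4 + c * y ^ 4 = 0 → x = 0 ∧ y = 0) :
    ∑ t, quarticSum ψ t * quarticSum ψ (c * t) = Fintype.card K := by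
  have h := sum_sum_addChar_mul hψ fun z : K × K => z.1 ^ 4 + c * z.2 ^ 4
  have hcard : Nat.card {z : K × K // z.1 ^ 4 + c * z.2 ^ 4 = 0} = 1 := by
    rw [Nat.card_eq_one_iff_unique]
    refine ⟨⟨fun ⟨z, hz⟩ ⟨w, hw⟩ => Subtype.ext (Prod.ext ?_ ?_)⟩, ⟨⟨0, by simp⟩⟩⟩
    · exact (hc _ _ hz).1.trans (hc _ _ hw).1.symm
    · exact (hc _ _ hz).2.trans (hc _ _ hw).2.symm
  rw [hcard, Nat.cast_one, mul_one] at h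
  rw [← h]
  refine Finset.sum_congr rfl fun t _ => ?_
  rw [quarticSum, quarticSum, Finset.sum_mul_sum, Fintype.sum_prod_type]
  refine Finset.sum_congr rfl fun x _ => Finset.sum_congr rfl fun y _ => ?_
  rw [← AddChar.map_add_eq_mul]
  congr 1
  ring

lemma sum_quarticSum {ψ : AddChar K ℂ} (hψ : ψ.IsPrimitive) :
    ∑ t, quarticSum ψ t = Fintype.card K := by
  have h := sum_sum_addChar_mul hψ fun x : K => x ^ 4
  have hcard : Nat.card {x : K // x ^ 4 = 0} = 1 := by simp
  rwa [hcard, Nat.cast_one, mul_one] at h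

lemma sum_quarticSum_pow_four {ψ : AddChar K ℂ} (hψ : ψ.IsPrimitive) :
    ∑ t, quarticSum ψ t ^ 4 = Fintype.card K *
      (Nat.card {v : Fin 4 → K // v 0 ^ 4 + v 1 ^ 4 + v 2 ^ 4 + v 3 ^ 4 = 0} : ℂ) := by
  rw [← sum_sum_addChar_mul hψ]
  refine Finset.sum_congr rfl fun t _ => ?_
  rw [quarticSum, Fintype.sum_pow]
  refine Finset.sum_congr rfl fun v _ => ?_
  simp only [Fin.prod_univ_four, ← AddChar.map_add_eq_mul]
  congr 1
  ring

/-- If the order of the unit group is divisible by `8`, then `-g` and `-g ^ 2` are not fourth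
powers for a generator `g` of that group. -/
lemma eq_zero_of_pow_four_add_generator_mul {g : Kˣ} (hg : ∀ t, t ∈ Subgroup.zpowers g)
    (h8 : 8 ∣ Fintype.card K - 1) {j : ℕ} (hj : j = 1 ∨ j = 2) (x y : K)
    (h : x ^ 4 + (g : K) ^ j * y ^ 4 = 0) : x = 0 ∧ y = 0 := by
  classical
  have hy : y = 0 := by
    by_contra hy
    obtain ⟨n, hn⟩ := h8
    have hpos : 1 < Fintype.card K := Fintype.one_lt_card
    have hord : orderOf g = 8 * n := by
      rw [orderOf_eq_card_of_forall_mem_zpowers hg, Nat.card_eq_fintype_card,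
        Fintype.card_units, hn]
    have hx : x ≠ 0 := by
      rintro rfl
      simp [hy] at h
    have hxy : (x / y) ^ 4 = -(g : K) ^ j := by
      field_simp
      linear_combination h
    have hone : (x / y) ^ (8 * n) = 1 := by
      rw [← hn]
      exact FiniteField.pow_card_sub_one_eq_one _ (div_ne_zero hx hy)
    have hgj : g ^ (j * (2 * n)) = 1 := by
      apply Units.ext
      rw [Units.val_pow_eq_pow_val, Units.val_one, pow_mul, pow_mul, ← neg_sq, ← hxy, ← hone,
        ← pow_mul, ← pow_mul]
      ring_nf
    have hdvd := orderOf_dvd_of_pow_eq_one hgj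
    rw [hord] at hdvd
    have := Nat.le_of_dvd (by rcases hj with rfl | rfl <;> omega) hdvd
    rcases hj with rfl | rfl <;> omega
  subst hy
  simpa using h

/-- The number of affine solutions of the Fermat quartic in four variables over a finite field
of characteristic `p ≡ 3 (mod 4)` in which `-1` is a fourth power. -/
lemma card_fermat_quartic_cone (p : ℕ) [Fact p.Prime] [CharP K p] (hp4 : p % 4 = 3)
    (h8 : 8 ∣ Fintype.card K - 1) :
    Nat.card {v : Fin 4 → K // v 0 ^ 4 + v 1 ^ 4 + v 2 ^ 4 + v 3 ^ 4 = 0} =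
      (Fintype.card K - 1) * (Fintype.card K ^ 2 + 22 * Fintype.card K + 1) + 1 := by
  classical
  obtain ⟨ψ, hψ, hfrob⟩ := exists_isPrimitive_frobenius_invariant (K := K) p
  obtain ⟨g, hg⟩ := IsCyclic.exists_generator (α := Kˣ)
  obtain ⟨S, hS⟩ : ∃ S, S = quarticSum ψ := ⟨_, rfl⟩
  have hinv (c : K) (t : Kˣ) : S (c * ((g ^ 4 * t : Kˣ) : K)) = S (c * t) := by
    rw [hS, ← quarticSum_pow_four_mul ψ g (c * t)]
    congr 1
    push_cast
    ring
  have hinv' (t : Kˣ) : S ((g ^ 4 * t : Kˣ) : K) = S t := by simpa using hinv 1 t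
  have hpow (k : ℕ) (t : K) : S ((g : K) ^ (4 * k) * t) = S t := by
    rw [hS, pow_mul', ← Units.val_pow_eq_pow_val, quarticSum_pow_four_mul]
  have hg3 : S ((g : K) ^ 3) = S g := by
    rw [hS, ← quarticSum_pow_char p hfrob (g : K), ← hS,
      show p = 4 * (p / 4) + 3 by omega, pow_add, hpow]
  have hg4 : S ((g : K) ^ 4) = S 1 := by simpa using hpow 1 1
  have hgsq : S (((g : K) ^ 2) ^ 2) = S 1 := by rw [← pow_mul, ← hg4]
  have hg5 : S ((g : K) ^ 5) = S g := by
    rw [← hpow 1 (g : K)]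
    ring_nf
  have hcard : (Fintype.card Kˣ : ℂ) = Fintype.card K - 1 := by
    rw [Fintype.card_units, Nat.cast_sub Fintype.card_pos, Nat.cast_one]
  have hQ1 : (Fintype.card K : ℂ) - 1 ≠ 0 := by
    rw [← hcard]
    exact_mod_cast Fintype.card_ne_zero
  have hS0 : S 0 = Fintype.card K := hS ▸ quarticSum_zero ψ
  have split (F : K → ℂ) (hF : ∀ t : Kˣ, F ((g ^ 4 * t : Kˣ) : K) = F t) :
      4 * (∑ t, F t) = 4 * F 0 + (Fintype.card K - 1) *
        (F 1 + F g + F ((g : K) ^ 2) + F ((g : K) ^ 3)) := by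
    have h := four_mul_sum_of_invariant hg (fun u : Kˣ => F u) hF
    rw [sum_univ_eq_zero_add_units, mul_add, h, hcard]
    simp
  have E0 := split S hinv'
  have E1 := split (fun t => S t * S ((g : K) ^ 1 * t)) fun t => by simp only [hinv, hinv']
  have E2 := split (fun t => S t * S ((g : K) ^ 2 * t)) fun t => by simp only [hinv, hinv']
  have E4 := split (fun t => S t ^ 4) fun t => by simp only [hinv']
  rw [hS, sum_quarticSum hψ, ← hS] at E0
  rw [hS, sum_quarticSum_mul_quarticSum hψ
    (eq_zero_of_pow_four_add_generator_mul hg h8 (Or.inl rfl)), ← hS] at E1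
  rw [hS, sum_quarticSum_mul_quarticSum hψ
    (eq_zero_of_pow_four_add_generator_mul hg h8 (Or.inr rfl)), ← hS] at E2
  rw [hS, sum_quarticSum_pow_four hψ, ← hS] at E4
  simp only [mul_one, mul_zero, pow_one, ← pow_succ', ← pow_succ, ← pow_add, ← sq, hS0, hg3,
    Nat.reduceAdd, hg4, hg5, hgsq] at E0 E1 E2 E4
  generalize S 1 = a at *
  generalize S g = b at *
  generalize S ((g : K) ^ 2) = c at *
  apply Nat.cast_injective (R := ℂ)
  have hQ0 : (Fintype.card K : ℂ) ≠ 0 := by exact_mod_cast Fintype.card_ne_zero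
  push_cast [Nat.cast_sub (Fintype.card_pos (α := K))]
  generalize (Fintype.card K : ℂ) = Q at *
  have h0 : a + 2 * b + c = 0 := mul_left_cancel₀ hQ1 (by linear_combination -E0)
  have hb : b ^ 2 = Q := mul_left_cancel₀ hQ1 (by
    linear_combination E1 / 4 + (Q - 1) * b / 2 * h0)
  have hac : a * c = -3 * Q := mul_left_cancel₀ hQ1 (by
    linear_combination -E2 / 2 - (Q - 1) * hb)
  have hsq : a ^ 2 + c ^ 2 = 10 * Q := by
    linear_combination (a + c - 2 * b) * h0 + 4 * hb - 2 * hac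
  have hfour : a ^ 4 + b ^ 4 + c ^ 4 + b ^ 4 = 84 * Q ^ 2 := by
    linear_combination (a ^ 2 + c ^ 2 + 10 * Q) * hsq - 2 * (a * c - 3 * Q) * hac
      + 2 * (b ^ 2 + Q) * hb
  apply mul_left_cancel₀ hQ0
  linear_combination E4 / 4 + (Q - 1) / 4 * hfour

end CharacterSums

/-- The number of points of a projective cone in terms of the number of points of its affine
cone. -/
lemma Projectivization.card_cone {K V : Type*} [Field K] [Fintype K] [AddCommGroup V] [Module K V]
    [Finite V] {P : V → Prop} (h0 : P 0) (hP : ∀ (u : Kˣ) v, P v → P (u • v)) :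
    Nat.card {v // P v} =
      (Fintype.card K - 1) * Nat.card {x : Projectivization K V // P x.rep} + 1 := by
  classical
  let f : Option (Kˣ × {x : Projectivization K V // P x.rep}) → {v // P v} := fun z =>
    z.elim ⟨0, h0⟩ fun y => ⟨y.1 • y.2.1.rep, hP _ _ y.2.2⟩
  have hf : Function.Bijective f := by
    have hne (u : Kˣ) (x : Projectivization K V) : u • x.rep ≠ 0 := by
      rw [Ne, smul_eq_zero_iff_eq]
      exact x.rep_nonzero
    constructor
    · rintro (_ | ⟨u, x, hx⟩) (_ | ⟨w, y, hy⟩) h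
      · rfl
      · exact absurd (congrArg Subtype.val h).symm (hne w y)
      · exact absurd (congrArg Subtype.val h) (hne u x)
      · replace h : u • x.rep = w • y.rep := congrArg Subtype.val h
        have hxy : x = y := by
          rw [← x.mk_rep, ← y.mk_rep, Projectivization.mk_eq_mk_iff]
          exact ⟨u⁻¹ * w, by rw [mul_smul, ← h, inv_smul_smul]⟩
        subst hxy
        have huw : u = w := by
          apply Units.ext
          exact smul_left_injective K x.rep_nonzero h
        rw [huw]
    · rintro ⟨v, hv⟩
      by_cases hv0 : v = 0
      · exact ⟨none, Subtype.ext hv0.symm⟩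
      · obtain ⟨u, hu⟩ := Projectivization.exists_smul_eq_mk_rep K v hv0
        refine ⟨some (u⁻¹, ⟨Projectivization.mk K v hv0, hu ▸ hP u v hv⟩), Subtype.ext ?_⟩
        simp [f, ← hu]
  rw [← Nat.card_eq_of_bijective f hf, Finite.card_option, Nat.card_prod,
    Nat.card_eq_fintype_card (α := Kˣ), Fintype.card_units]

/-- Let `p ≡ 3 (mod 4)` be a prime and `q = p²`.  For every `m ≥ 1`,
the number of points over 𝔽_{q^m} = 𝔽_{p^{2m}} of the Fermat quartic surface
`x₀⁴ + x₁⁴ + x₂⁴ + x₃⁴ = 0` in ℙ³ equals `q^{2m} + 22·q^m + 1 = p^{4m} + 22·p^{2m} + 1`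
(so the Frobenius of 𝔽_q acts on the 22-dimensional `H²` as multiplication by `q`,
i.e. the surface is strongly supersingular in degree 2 over 𝔽_{p²}). -/
theorem stmt10 (p : ℕ) [Fact p.Prime] (hp4 : p % 4 = 3) (m : ℕ) (hm : 1 ≤ m) :
    Nat.card {x : Projectivization (GaloisField p (2 * m))
        (Fin 4 → GaloisField p (2 * m)) //
      x.rep 0 ^ 4 + x.rep 1 ^ 4 + x.rep 2 ^ 4 + x.rep 3 ^ 4 = 0} =
      p ^ (4 * m) + 22 * p ^ (2 * m) + 1 := by
  let _ := Fintype.ofFinite (GaloisField p (2 * m))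
  have hcard : Fintype.card (GaloisField p (2 * m)) = p ^ (2 * m) := by
    rw [← Nat.card_eq_fintype_card, GaloisField.card p (2 * m) (by omega)]
  have h8 : 8 ∣ Fintype.card (GaloisField p (2 * m)) - 1 := by
    have hodd : Odd (p ^ m) := (Nat.odd_iff.mpr (by omega)).pow
    rw [hcard, mul_comm, pow_mul]
    exact Nat.eight_dvd_sq_sub_one_of_odd hodd
  have hcone := card_fermat_quartic_cone (K := GaloisField p (2 * m)) p hp4 h8
  rw [Projectivization.card_cone (K := GaloisField p (2 * m))
    (P := fun v : Fin 4 → GaloisField p (2 * m) => v 0 ^ 4 + v 1 ^ 4 + v 2 ^ 4 + v 3 ^ 4 = 0)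
    (by simp) fun u v hv => by
      simp only [Pi.smul_apply, Units.smul_def, smul_eq_mul]
      linear_combination (u : GaloisField p (2 * m)) ^ 4 * hv] at hcone
  have hpos : 0 < Fintype.card (GaloisField p (2 * m)) - 1 :=
    Nat.sub_pos_of_lt Fintype.one_lt_card
  refine (Nat.eq_of_mul_eq_mul_left hpos (Nat.succ_injective hcone)).trans ?_
  rw [hcard]
  ring
end
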